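/- arXiv:2410.06117 — 2 statements merged into one kernel-verified Lean document; each statement's English description precedes it below -/
import Mathlib

section
/- Let f : ℕ → ℝ be bounded. For t ≥ 0 define the Poisson semigroup P_t f(k) := Σ_{n∈ℕ} f(k+n) π_t(n), where π_t(n) = e^{-t} t^n / n!. Then for every k ∈ ℕ, the function t ↦ P_t f(k) is differentiable on (0,∞) and satisfies the heat equation ∂_t P_t f(k) = P_t f(k+1) − P_t f(k). -/
/-- The Poisson measure on ℕ with intensity `t`: `π_t(n) = e^{-t} t^n / n!`. -/
noncomputable def poissonPMF (t : ℝ) (n : ℕ) : ℝ :=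
  Real.exp (-t) * t ^ n / (Nat.factorial n)

/-- The Poisson semigroup `P_t f(k) = Σ_{n∈ℕ} f(k+n) π_t(n)`. -/
noncomputable def poissonSemigroup (t : ℝ) (f : ℕ → ℝ) (k : ℕ) : ℝ :=
  ∑' n : ℕ, f (k + n) * poissonPMF t n

theorem summable_mul_pow_div_factorial {a : ℕ → ℝ} {M : ℝ} (ha : ∀ n, |a n| ≤ M) (t : ℝ) :
    Summable fun n => a n * (t ^ n / (n.factorial : ℝ)) := by
  refine .of_norm_bounded ((Real.summable_pow_div_factorial |t|).mul_left M) fun n => ?_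
  rw [Real.norm_eq_abs, abs_mul, abs_div, abs_pow, Nat.abs_cast]
  exact mul_le_mul_of_nonneg_right (ha n) (by positivity)

theorem succ_mul_pow_div_factorial_succ (t : ℝ) (n : ℕ) :
    ((n + 1 : ℕ) : ℝ) * t ^ n / ((n + 1).factorial : ℝ) = t ^ n / (n.factorial : ℝ) := by
  rw [Nat.factorial_succ, Nat.cast_mul]
  exact mul_div_mul_left _ _ (by positivity)

/-- An exponential generating function with bounded coefficients is differentiated by shifting
its coefficients. -/
theorem hasDerivAt_tsum_mul_pow_div_factorial {a : ℕ → ℝ} {M : ℝ} (ha : ∀ n, |a n| ≤ M) (t : ℝ) :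
    HasDerivAt (fun s : ℝ => ∑' n, a n * (s ^ n / (n.factorial : ℝ)))
      (∑' n, a (n + 1) * (t ^ n / (n.factorial : ℝ))) t := by
  set R : ℝ := |t| + 1
  have ht : t ∈ Metric.ball (0 : ℝ) R := by simp [R]
  have hu : Summable fun n : ℕ => M * ((n : ℝ) * R ^ (n - 1) / (n.factorial : ℝ)) := by
    rw [← summable_nat_add_iff 1]
    simp only [add_tsub_cancel_right, succ_mul_pow_div_factorial_succ]
    exact (Real.summable_pow_div_factorial R).mul_left M
  have hderiv := hasDerivAt_tsum_of_isPreconnected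
    (g := fun n s => a n * (s ^ n / (n.factorial : ℝ)))
    (g' := fun n s => a n * ((n : ℝ) * s ^ (n - 1) / (n.factorial : ℝ)))
    hu Metric.isOpen_ball (convex_ball (0 : ℝ) R).isPreconnected
    (fun n s _ => ((hasDerivAt_pow n s).div_const _).const_mul _)
    (fun n s hs => by
      have hs' : |s| ≤ R := by simpa using (mem_ball_zero_iff.mp hs).le
      rw [Real.norm_eq_abs, abs_mul, abs_div, abs_mul, abs_pow, Nat.abs_cast, Nat.abs_cast]
      have hM : 0 ≤ M := (abs_nonneg _).trans (ha n)
      gcongr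
      exact ha n)
    ht (summable_mul_pow_div_factorial ha t) ht
  have hs : Summable fun n : ℕ => a n * ((n : ℝ) * t ^ (n - 1) / (n.factorial : ℝ)) := by
    rw [← summable_nat_add_iff 1]
    simp only [add_tsub_cancel_right, succ_mul_pow_div_factorial_succ]
    exact summable_mul_pow_div_factorial (fun n => ha (n + 1)) t
  rw [hs.tsum_eq_zero_add] at hderiv
  simpa only [add_tsub_cancel_right, succ_mul_pow_div_factorial_succ, Nat.cast_zero, zero_mul,
    zero_div, mul_zero, zero_add] using hderiv

theorem poissonSemigroup_eq_exp_mul_tsum (t : ℝ) (f : ℕ → ℝ) (k : ℕ) :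
    poissonSemigroup t f k =
      Real.exp (-t) * ∑' n, f (k + n) * (t ^ n / (n.factorial : ℝ)) := by
  rw [poissonSemigroup, ← tsum_mul_left]
  exact tsum_congr fun n => by rw [poissonPMF]; ring

/-- For bounded `f`, the Poisson semigroup satisfies the heat equation
`∂_t P_t f(k) = P_t f(k+1) − P_t f(k)` (differentiability in `t` on `(0,∞)` included). -/
theorem poisson_semigroup_heat_equation (f : ℕ → ℝ) (hbd : ∃ M : ℝ, ∀ k, |f k| ≤ M)
    (k : ℕ) (t : ℝ) (ht : 0 < t) :
    HasDerivAt (fun s : ℝ => poissonSemigroup s f k)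
      (poissonSemigroup t f (k + 1) - poissonSemigroup t f k) t := by
  obtain ⟨M, hM⟩ := hbd
  have hE : HasDerivAt (fun s : ℝ => Real.exp (-s)) (-Real.exp (-t)) t := by
    simpa using (hasDerivAt_neg t).exp
  have hmul := hE.mul (hasDerivAt_tsum_mul_pow_div_factorial (fun n => hM (k + n)) t)
  simp only [poissonSemigroup_eq_exp_mul_tsum]
  refine hmul.congr_deriv ?_
  simp only [add_right_comm k 1, ← add_assoc]
  ring
end

section
/- Let f : ℕ → (0,∞) be ultra-log-concave and bounded, and let P_t denote the Poisson semigroup. Then for every t ≥ 0, P_t f(0) / P_t f(1) ≥ f(0) / f(1); equivalently, for fixed T > 0 the function [0,T] ∋ s ↦ P_{T−s} f(0) / P_{T−s} f(1) is non-increasing in s. -/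
/-- `f : ℕ → ℝ` is ultra-log-concave: `k f(k)² ≥ (k+1) f(k+1) f(k−1)` for all `k ∈ ℕ`,
with the convention `f(−1) := 0` (the case `k = 0` is vacuous, so we state the condition
for `k + 1`, `k ∈ ℕ`). -/
def UltraLogConcave (f : ℕ → ℝ) : Prop :=
  ∀ k : ℕ, ((k : ℝ) + 2) * f (k + 2) * f k ≤ ((k : ℝ) + 1) * (f (k + 1)) ^ 2

theorem UltraLogConcave.antitone_ratio {f : ℕ → ℝ} (hf : ∀ k, 0 < f k)
    (hulc : UltraLogConcave f) : Antitone fun k => f (k + 1) / f k := by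
  refine antitone_nat_of_succ_le fun k => ?_
  rw [div_le_div_iff₀ (hf _) (hf _)]
  have hk : (0 : ℝ) < (k : ℝ) + 1 := by positivity
  have hprod := mul_pos (hf (k + 2)) (hf k)
  refine le_of_mul_le_mul_left ?_ hk
  nlinarith [hulc k]

theorem summable_poissonPMF (t : ℝ) : Summable (poissonPMF t) := by
  refine ((Real.summable_pow_div_factorial t).mul_left (Real.exp (-t))).congr fun n => ?_
  rw [poissonPMF, mul_div_assoc]

theorem poissonPMF_nonneg {t : ℝ} (ht : 0 ≤ t) (n : ℕ) : 0 ≤ poissonPMF t n := by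
  unfold poissonPMF
  positivity

theorem summable_mul_poissonPMF {f : ℕ → ℝ} (hf : ∀ k, 0 ≤ f k) {M : ℝ} (hM : ∀ k, f k ≤ M)
    {t : ℝ} (ht : 0 ≤ t) (k : ℕ) : Summable fun n => f (k + n) * poissonPMF t n :=
  Summable.of_nonneg_of_le (fun n => mul_nonneg (hf _) (poissonPMF_nonneg ht n))
    (fun n => mul_le_mul_of_nonneg_right (hM _) (poissonPMF_nonneg ht n))
    ((summable_poissonPMF t).mul_left M)

theorem poissonSemigroup_pos {f : ℕ → ℝ} (hf : ∀ k, 0 < f k) {M : ℝ} (hM : ∀ k, f k ≤ M)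
    {t : ℝ} (ht : 0 ≤ t) (k : ℕ) : 0 < poissonSemigroup t f k := by
  refine (summable_mul_poissonPMF (fun k => (hf k).le) hM ht k).tsum_pos
    (fun n => mul_nonneg (hf _).le (poissonPMF_nonneg ht n)) 0 (mul_pos (hf _) ?_)
  simp [poissonPMF, Real.exp_pos]

theorem poissonSemigroup_zero (f : ℕ → ℝ) (k : ℕ) : poissonSemigroup 0 f k = f k := by
  unfold poissonSemigroup
  rw [tsum_eq_single 0]
  · simp [poissonPMF]
  · intro n hn
    simp [poissonPMF, hn]

/-- The Poisson family has monotone likelihood ratio in its intensity. -/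
theorem poissonPMF_mul_le {s t : ℝ} (hs : 0 ≤ s) (hst : s ≤ t) {n m : ℕ} (hnm : n ≤ m) :
    poissonPMF t n * poissonPMF s m ≤ poissonPMF s n * poissonPMF t m := by
  obtain ⟨d, rfl⟩ := Nat.exists_eq_add_of_le hnm
  have hpow : s ^ d ≤ t ^ d := pow_le_pow_left₀ hs hst d
  have ht := hs.trans hst
  have hc : 0 ≤ Real.exp (-t) * Real.exp (-s) * (s ^ n * t ^ n) /
      (n.factorial * (n + d).factorial) := by positivity
  calc poissonPMF t n * poissonPMF s (n + d)
      = Real.exp (-t) * Real.exp (-s) * (s ^ n * t ^ n) /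
        (n.factorial * (n + d).factorial) * s ^ d := by
        unfold poissonPMF; rw [pow_add]; ring
    _ ≤ Real.exp (-t) * Real.exp (-s) * (s ^ n * t ^ n) /
        (n.factorial * (n + d).factorial) * t ^ d := mul_le_mul_of_nonneg_left hpow hc
    _ = poissonPMF s n * poissonPMF t (n + d) := by
        unfold poissonPMF; rw [pow_add]; ring

theorem tsum_le_tsum_of_add_swap_le {u v : ℕ × ℕ → ℝ} (hu : Summable u) (hv : Summable v)
    (huv : ∀ n m, n ≤ m → u (n, m) + u (m, n) ≤ v (n, m) + v (m, n)) :
    ∑' p, u p ≤ ∑' p, v p := by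
  have hdouble {w : ℕ × ℕ → ℝ} (hw : Summable w) :
      HasSum (fun p => w p + w p.swap) (∑' p, w p + ∑' p, w p) :=
    hw.hasSum.add ((Equiv.prodComm ℕ ℕ).hasSum_iff.2 hw.hasSum)
  have hle : ∀ p : ℕ × ℕ, u p + u p.swap ≤ v p + v p.swap := by
    rintro ⟨n, m⟩
    rcases le_total n m with h | h
    · exact huv n m h
    · rw [add_comm (u _), add_comm (v _)]
      exact huv m n h
  linarith [hasSum_le hle (hdouble hu) (hdouble hv)]

theorem poissonSemigroup_mul_le {f : ℕ → ℝ} (hf : ∀ k, 0 < f k) {M : ℝ} (hM : ∀ k, f k ≤ M)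
    (hanti : Antitone fun k => f (k + 1) / f k) {s t : ℝ} (hs : 0 ≤ s) (hst : s ≤ t) :
    poissonSemigroup s f 0 * poissonSemigroup t f 1 ≤
      poissonSemigroup t f 0 * poissonSemigroup s f 1 := by
  have ht := hs.trans hst
  have hsum {r : ℝ} (hr : 0 ≤ r) (k : ℕ) := summable_mul_poissonPMF (fun k => (hf k).le) hM hr k
  let u (x y : ℝ) (p : ℕ × ℕ) : ℝ :=
    (f (0 + p.1) * poissonPMF x p.1) * (f (1 + p.2) * poissonPMF y p.2)
  have hu {x y : ℝ} (hx : 0 ≤ x) (hy : 0 ≤ y) : Summable (u x y) :=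
    summable_mul_of_summable_norm (hsum hx 0).norm (hsum hy 1).norm
  have hprod {x y : ℝ} (hx : 0 ≤ x) (hy : 0 ≤ y) :
      poissonSemigroup x f 0 * poissonSemigroup y f 1 = ∑' p, u x y p :=
    tsum_mul_tsum_of_summable_norm (hsum hx 0).norm (hsum hy 1).norm
  have hpair (n m : ℕ) (hnm : n ≤ m) :
      u s t (n, m) + u s t (m, n) ≤ u t s (n, m) + u t s (m, n) := by
    have hratio := hanti hnm
    rw [div_le_div_iff₀ (hf _) (hf _)] at hratio
    have hmlr := poissonPMF_mul_le hs hst hnm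
    simp only [u, zero_add, add_comm 1]
    nlinarith [mul_nonneg (sub_nonneg.2 hratio) (sub_nonneg.2 hmlr)]
  rw [hprod hs ht, hprod ht hs]
  exact tsum_le_tsum_of_add_swap_le (hu hs ht) (hu ht hs) hpair

theorem monotoneOn_poissonSemigroup_ratio {f : ℕ → ℝ} (hf : ∀ k, 0 < f k) {M : ℝ}
    (hM : ∀ k, f k ≤ M) (hanti : Antitone fun k => f (k + 1) / f k) :
    MonotoneOn (fun t => poissonSemigroup t f 0 / poissonSemigroup t f 1) (Set.Ici 0) := by
  intro s hs t ht hst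
  simp only
  rw [div_le_div_iff₀ (poissonSemigroup_pos hf hM hs 1) (poissonSemigroup_pos hf hM ht 1)]
  exact poissonSemigroup_mul_le hf hM hanti hs hst

/-- For ultra-log-concave bounded `f : ℕ → (0,∞)`: for every `t ≥ 0`,
`P_t f(0)/P_t f(1) ≥ f(0)/f(1)`; equivalently, for fixed `T > 0` the map
`s ↦ P_{T−s} f(0)/P_{T−s} f(1)` is non-increasing on `[0,T]`. -/
theorem ulc_ratio_monotone (f : ℕ → ℝ) (hf : ∀ k, 0 < f k)
    (hbd : ∃ M : ℝ, ∀ k, f k ≤ M) (hulc : UltraLogConcave f) :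
    (∀ t : ℝ, 0 ≤ t →
      f 0 / f 1 ≤ poissonSemigroup t f 0 / poissonSemigroup t f 1) ∧
    (∀ T : ℝ, 0 < T →
      AntitoneOn (fun s : ℝ => poissonSemigroup (T - s) f 0 / poissonSemigroup (T - s) f 1)
        (Set.Icc (0 : ℝ) T)) := by
  obtain ⟨M, hM⟩ := hbd
  have hmono := monotoneOn_poissonSemigroup_ratio hf hM (hulc.antitone_ratio hf)
  refine ⟨fun t ht => ?_, fun T _ => ?_⟩
  · simpa only [poissonSemigroup_zero] using hmono Set.self_mem_Ici ht ht
  · intro a ha b hb hab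
    exact hmono (sub_nonneg.2 hb.2) (sub_nonneg.2 ha.2) (sub_le_sub_left hab T)
end
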